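/- Let p be an odd prime and K as below. Let N ≥ 1, k ≥ 1, let ω₁,…,ω_N ∈ K, and let x ∈ K with ‖x‖ > max_{1≤i≤N} ‖ω_i‖. Then: (i) for every t̄ ∈ ℕ^N the element x + ω₁t₁ + ⋯ + ω_N t_N is nonzero (indeed it has norm ‖x‖); (ii) the family j ↦ C(−k,j)·E_{N,j}(0;ω̄)·x^{−k−j}, indexed by j ∈ ℕ, where C(−k,j) = (−1)^j·binom(k+j−1, j) ∈ ℤ is the generalized binomial coefficient binom(−k,j), is summable in K; and (iii) as l → ∞, the N-fold alternating sums ∑_{t₁=0}^{p^l−1}⋯∑_{t_N=0}^{p^l−1} (−1)^{t₁+⋯+t_N}·(x + ω₁t₁ + ⋯ + ω_N t_N)^{−k} converge in K to ∑_{j=0}^∞ C(−k,j)·E_{N,j}(0;ω̄)·x^{−k−j}. -/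

import Mathlib

noncomputable def twoUnit (A : Type*) [CommRing A] [Algebra ℚ A] : Aˣ where
  val := 2
  inv := algebraMap ℚ A (1 / 2)
  val_inv := by
    rw [show (2 : A) = algebraMap ℚ A 2 from (map_ofNat (algebraMap ℚ A) 2).symm, ← map_mul]
    norm_num
  inv_val := by
    rw [show (2 : A) = algebraMap ℚ A 2 from (map_ofNat (algebraMap ℚ A) 2).symm, ← map_mul]
    norm_num

/-- Higher-order Euler polynomial `E_{N,n}(x; ω)`, defined via the generating-function
identity `∑_{n≥0} E_{N,n}(x;ω)·Tⁿ/n! = 2^N·exp(xT)·∏_{j=1}^N (exp(ωⱼT)+1)⁻¹` in `A⟦T⟧`,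
where each factor `exp(ωⱼT)+1` is invertible since its constant term is `2`. -/
noncomputable def eulerHO (A : Type*) [CommRing A] [Algebra ℚ A]
    (N : ℕ) (ω : Fin N → A) (x : A) (n : ℕ) : A :=
  (n.factorial : A) * PowerSeries.coeff n
    ((2 : A) ^ N • (PowerSeries.rescale x (PowerSeries.exp A) *
      ∏ j : Fin N,
        PowerSeries.invOfUnit (PowerSeries.rescale (ω j) (PowerSeries.exp A) + 1) (twoUnit A)))

/-- The generalized binomial coefficient `binom(−k, j) = (−1)^j·binom(k+j−1, j)`. -/
def genBinom (k j : ℕ) : ℤ := (-1) ^ j * ((k + j - 1).choose j)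

theorem aux_exp_prod {K : Type*} [Field K] [CharZero K] {ι : Type*} (s : Finset ι) (a : ι → K) :
    ∏ i ∈ s, PowerSeries.rescale (a i) (PowerSeries.exp K)
      = PowerSeries.rescale (∑ i ∈ s, a i) (PowerSeries.exp K) := by
  classical
  induction s using Finset.induction_on with
  | empty => simp
  | insert i s hi ih =>
    rw [Finset.prod_insert hi, Finset.sum_insert hi, ih, PowerSeries.exp_mul_exp_eq_exp_add]

theorem aux_exp_pow {K : Type*} [Field K] [CharZero K] (a : K) (n : ℕ) :
    PowerSeries.rescale (a * n) (PowerSeries.exp K)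
      = (PowerSeries.rescale a (PowerSeries.exp K)) ^ n := by
  have := aux_exp_prod (Finset.range n) (fun _ => a)
  simp only [Finset.prod_const, Finset.card_range, Finset.sum_const, nsmul_eq_mul] at this
  rw [this, mul_comm]

theorem aux_geom {K : Type*} [Field K] [CharZero K] (a : K) (m : ℕ) (hm : Odd m) :
    ∑ t ∈ Finset.range m, (-1 : PowerSeries K) ^ t *
        PowerSeries.rescale (a * t) (PowerSeries.exp K)
      = (PowerSeries.rescale (a * m) (PowerSeries.exp K) + 1) *
        PowerSeries.invOfUnit (PowerSeries.rescale a (PowerSeries.exp K) + 1) (twoUnit K) := by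
  have h1 : (PowerSeries.rescale a (PowerSeries.exp K) + 1) *
      PowerSeries.invOfUnit (PowerSeries.rescale a (PowerSeries.exp K) + 1) (twoUnit K) = 1 := by
    apply PowerSeries.mul_invOfUnit
    rw [map_add, ← PowerSeries.coeff_zero_eq_constantCoeff_apply, PowerSeries.coeff_rescale]
    simp [twoUnit]
    norm_num
  set e := PowerSeries.rescale a (PowerSeries.exp K)
  have h2 : (∑ t ∈ Finset.range m, (-e) ^ t) * (e + 1) = e ^ m + 1 := by
    have := geom_sum_mul_neg (-e) m
    rw [hm.neg_pow] at this
    linear_combination this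
  have h3 : ∑ t ∈ Finset.range m, (-1 : PowerSeries K) ^ t *
        PowerSeries.rescale (a * t) (PowerSeries.exp K) = ∑ t ∈ Finset.range m, (-e) ^ t := by
    refine Finset.sum_congr rfl fun t _ => ?_
    rw [aux_exp_pow, ← mul_pow]; simp [e]
  rw [h3, aux_exp_pow, ← h2, mul_assoc, h1, mul_one]

/-- The power sums as coefficients. -/
theorem aux_power_sum {K : Type*} [Field K] [CharZero K] (N : ℕ) (ω : Fin N → K) (m : ℕ)
    (hm : Odd m) (j : ℕ) :
    ∑ t ∈ Fintype.piFinset (fun _ : Fin N => Finset.range m),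
          (-1 : K) ^ (∑ i, t i) * (∑ i, ω i * (t i : K)) ^ j
      = (j.factorial : K) * PowerSeries.coeff j
        ((∏ i : Fin N, (PowerSeries.rescale (ω i * (m : K)) (PowerSeries.exp K) + 1)) *
          ∏ i : Fin N, PowerSeries.invOfUnit
            (PowerSeries.rescale (ω i) (PowerSeries.exp K) + 1) (twoUnit K)) := by
  rw [← Finset.prod_mul_distrib]
  simp_rw [← aux_geom _ m hm]
  rw [Finset.prod_univ_sum, map_sum, Finset.mul_sum]
  refine Finset.sum_congr rfl fun t _ => ?_
  rw [Finset.prod_mul_distrib, aux_exp_prod, Finset.prod_pow_eq_pow_sum]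
  have : ((-1 : PowerSeries K) ^ (∑ i, t i)) = PowerSeries.C ((-1 : K) ^ (∑ i, t i)) := by simp
  rw [this, PowerSeries.coeff_C_mul, PowerSeries.coeff_rescale, PowerSeries.coeff_exp]
  have : (j.factorial : K) ≠ 0 := by exact_mod_cast j.factorial_ne_zero
  simp
  field_simp

open scoped PowerSeries.WithPiTopology in
theorem aux_cont {K : Type*} [NontriviallyNormedField K] [CharZero K] (N : ℕ) (ω : Fin N → K)
    (G : PowerSeries K) (j : ℕ) :
    Continuous (fun z : K => (j.factorial : K) * PowerSeries.coeff j
        ((∏ i : Fin N, (PowerSeries.rescale (ω i * z) (PowerSeries.exp K) + 1)) * G)) := by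
  refine continuous_const.mul ((PowerSeries.WithPiTopology.continuous_coeff K j).comp ?_)
  refine (continuous_finsetProd _ fun i _ => ?_).mul continuous_const
  refine Continuous.add ?_ continuous_const
  rw [continuous_iff_continuousAt]
  intro z
  rw [ContinuousAt, PowerSeries.WithPiTopology.tendsto_iff_coeff_tendsto]
  intro d
  simp only [PowerSeries.coeff_rescale]
  exact Continuous.tendsto (f := fun z : K => (ω i * z) ^ d * _) (by fun_prop) z

theorem aux_tendsto (p : ℕ) [Fact p.Prime] (hp : p ≠ 2)
    (K : Type*) [NontriviallyNormedField K] [NormedAlgebra ℚ_[p] K] [CharZero K]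
    (N : ℕ) (ω : Fin N → K) (j : ℕ) :
    Filter.Tendsto (fun l : ℕ =>
        ∑ t ∈ Fintype.piFinset (fun _ : Fin N => Finset.range (p ^ l)),
          (-1 : K) ^ (∑ i, t i) * (∑ i, ω i * (t i : K)) ^ j)
      Filter.atTop (nhds (eulerHO K N ω 0 j)) := by
  have hodd : Odd p := (Fact.out : p.Prime).odd_of_ne_two hp
  simp_rw [fun l => aux_power_sum N ω (p ^ l) hodd.pow j]
  have hpn : ‖(p : K)‖ < 1 := by
    have h := norm_algebraMap' K (p : ℚ_[p])
    rw [map_natCast] at h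
    rw [h]
    exact Padic.norm_p_lt_one
  have h0 : Filter.Tendsto (fun l : ℕ => ((p ^ l : ℕ) : K)) Filter.atTop (nhds 0) := by
    simpa using tendsto_pow_atTop_nhds_zero_of_norm_lt_one hpn
  have h := ((aux_cont N ω (∏ i : Fin N, PowerSeries.invOfUnit
            (PowerSeries.rescale (ω i) (PowerSeries.exp K) + 1) (twoUnit K)) j).tendsto 0).comp h0
  suffices he : eulerHO K N ω 0 j = _ by rw [he]; exact h
  unfold eulerHO
  simp only [mul_zero, PowerSeries.rescale_zero_apply]
  congr 2
  simp [PowerSeries.smul_eq_C_mul]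
  left
  rw [map_ofNat]
  try norm_num

theorem aux_binom {K : Type*} [NontriviallyNormedField K] [CompleteSpace K] (k : ℕ) (hk : 1 ≤ k)
    (x y : K) (h : ‖y‖ < ‖x‖) :
    HasSum (fun j : ℕ => (genBinom k j : K) * y ^ j * x ^ (-(k : ℤ) - (j : ℤ)))
      ((x + y) ^ (-(k : ℤ))) := by
  have hx : x ≠ 0 := by
    rintro rfl
    simp at h
    exact absurd h (not_lt.2 (norm_nonneg y))
  obtain ⟨k, rfl⟩ := Nat.exists_eq_add_of_le' hk
  have hr : ‖-y / x‖ < 1 := by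
    rw [norm_div, norm_neg, div_lt_one (norm_pos_iff.2 hx)]; exact h
  have hs := (hasSum_choose_mul_geometric_of_norm_lt_one k hr).mul_left (x ^ (-((k + 1 : ℕ) : ℤ)))
  have e1 : (fun j : ℕ => (genBinom (k + 1) j : K) * y ^ j * x ^ (-((k + 1 : ℕ) : ℤ) - (j : ℤ)))
      = fun j : ℕ => x ^ (-((k + 1 : ℕ) : ℤ)) * (((j + k).choose k : K) * (-y / x) ^ j) := by
    funext j
    have hc : (k + 1 + j - 1).choose j = (j + k).choose k := by
      rw [show k + 1 + j - 1 = j + k by omega, Nat.choose_symm_add]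
    rw [genBinom, hc, zpow_sub₀ hx]
    push_cast
    rw [neg_div, neg_pow (y / x), div_pow, zpow_natCast]
    ring
  have e2 : (x + y) ^ (-((k + 1 : ℕ) : ℤ)) =
      x ^ (-((k + 1 : ℕ) : ℤ)) * (1 / (1 - -y / x) ^ (k + 1)) := by
    rw [zpow_neg, zpow_neg, zpow_natCast, zpow_natCast, one_div, ← mul_inv, ← mul_pow]
    congr 2
    field_simp
    ring
  rw [e1, e2]
  exact hs

/-- Let `p` be an odd prime and `K` a complete nontrivially normed
ultrametric field which is a normed `ℚ_[p]`-algebra. Let `N ≥ 1`, `k ≥ 1`, `ω₁,…,ω_N ∈ K`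
and `x ∈ K` with `‖x‖ > maxᵢ ‖ωᵢ‖`. Then: (i) each `x + ω₁t₁+⋯+ω_Nt_N` is nonzero, of norm
`‖x‖`; (ii) the family `j ↦ binom(−k,j)·E_{N,j}(0;ω̄)·x^{−k−j}` is summable in `K`; and
(iii) the `N`-fold alternating sums
`∑_{t₁=0}^{p^l−1}⋯∑_{t_N=0}^{p^l−1} (−1)^{t₁+⋯+t_N} (x+ω₁t₁+⋯+ω_Nt_N)^{−k}` converge, as
`l → ∞`, to `∑_{j=0}^∞ binom(−k,j)·E_{N,j}(0;ω̄)·x^{−k−j}`. -/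
theorem stmt11 (p : ℕ) [Fact p.Prime] (hp : p ≠ 2)
    (K : Type*) [NontriviallyNormedField K] [CompleteSpace K]
    [NormedAlgebra ℚ_[p] K] [IsUltrametricDist K] [CharZero K]
    (N k : ℕ) (hN : 1 ≤ N) (hk : 1 ≤ k) (ω : Fin N → K) (x : K)
    (hx : ∀ i, ‖ω i‖ < ‖x‖) :
    (∀ t : Fin N → ℕ,
        x + ∑ i, ω i * (t i : K) ≠ 0 ∧ ‖x + ∑ i, ω i * (t i : K)‖ = ‖x‖) ∧
    Summable (fun j : ℕ =>
        (genBinom k j : K) * eulerHO K N ω 0 j * x ^ (-(k : ℤ) - (j : ℤ))) ∧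
    Filter.Tendsto (fun l : ℕ =>
        ∑ t ∈ Fintype.piFinset (fun _ : Fin N => Finset.range (p ^ l)),
          (-1 : K) ^ (∑ i, t i) * (x + ∑ i, ω i * (t i : K)) ^ (-(k : ℤ)))
      Filter.atTop
      (nhds (∑' j : ℕ,
        (genBinom k j : K) * eulerHO K N ω 0 j * x ^ (-(k : ℤ) - (j : ℤ)))) := by
  have : Nonempty (Fin N) := ⟨⟨0, hN⟩⟩
  obtain ⟨i0, hi0⟩ := Finite.exists_max (fun i => ‖ω i‖)
  set M := ‖ω i0‖ with hM
  have hM0 : 0 ≤ M := norm_nonneg _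
  have hMx : M < ‖x‖ := hx i0
  have hxp : 0 < ‖x‖ := hM0.trans_lt hMx
  have hx0 : x ≠ 0 := norm_pos_iff.1 hxp
  have hy : ∀ t : Fin N → ℕ, ‖∑ i, ω i * (t i : K)‖ ≤ M := by
    intro t
    refine IsUltrametricDist.norm_sum_le_of_forall_le_of_nonneg hM0 fun i _ => ?_
    rw [norm_mul]
    exact (mul_le_of_le_one_right (norm_nonneg _)
      (IsUltrametricDist.norm_natCast_le_one K _)).trans (hi0 i)
  have hnorm : ∀ t : Fin N → ℕ, ‖x + ∑ i, ω i * (t i : K)‖ = ‖x‖ := by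
    intro t
    have hlt := (hy t).trans_lt hMx
    rw [IsUltrametricDist.norm_add_eq_max_of_norm_ne_norm hlt.ne', max_eq_left hlt.le]
  -- bound on power sums
  have hS : ∀ l j : ℕ, ‖∑ t ∈ Fintype.piFinset (fun _ : Fin N => Finset.range (p ^ l)),
          (-1 : K) ^ (∑ i, t i) * (∑ i, ω i * (t i : K)) ^ j‖ ≤ M ^ j := by
    intro l j
    refine IsUltrametricDist.norm_sum_le_of_forall_le_of_nonneg (by positivity) fun t _ => ?_
    rw [norm_mul, norm_pow, norm_pow, norm_neg, norm_one, one_pow, one_mul]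
    exact pow_le_pow_left₀ (norm_nonneg _) (hy t) j
  have hT := aux_tendsto p hp K N ω
  have hE : ∀ j, ‖eulerHO K N ω 0 j‖ ≤ M ^ j := fun j =>
    le_of_tendsto (hT j).norm (Filter.Eventually.of_forall fun l => hS l j)
  have hB : ∀ (j : ℕ) (a : K), ‖a‖ ≤ M ^ j →
      ‖(genBinom k j : K) * a * x ^ (-(k : ℤ) - (j : ℤ))‖
        ≤ ‖x‖ ^ (-(k : ℤ)) * (M / ‖x‖) ^ j := by
    intro j a ha
    rw [norm_mul, norm_mul, norm_zpow, zpow_sub₀ hxp.ne', zpow_natCast, div_pow]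
    have h1 : ‖(genBinom k j : K)‖ ≤ 1 := IsUltrametricDist.norm_intCast_le_one K _
    calc ‖(genBinom k j : K)‖ * ‖a‖ * (‖x‖ ^ (-(k : ℤ)) / ‖x‖ ^ j)
        ≤ 1 * M ^ j * (‖x‖ ^ (-(k : ℤ)) / ‖x‖ ^ j) := by gcongr
      _ = _ := by ring
  have hsum : Summable (fun j : ℕ => ‖x‖ ^ (-(k : ℤ)) * (M / ‖x‖) ^ j) :=
    (summable_geometric_of_lt_one (by positivity) ((div_lt_one hxp).2 hMx)).mul_left _
  refine ⟨fun t => ⟨?_, hnorm t⟩, ?_, ?_⟩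
  · rw [← norm_pos_iff, hnorm t]; exact hxp
  · exact Summable.of_norm_bounded hsum fun j => hB j _ (hE j)
  · have key : ∀ l : ℕ, ∑ t ∈ Fintype.piFinset (fun _ : Fin N => Finset.range (p ^ l)),
          (-1 : K) ^ (∑ i, t i) * (x + ∑ i, ω i * (t i : K)) ^ (-(k : ℤ))
        = ∑' j : ℕ, (genBinom k j : K) *
          (∑ t ∈ Fintype.piFinset (fun _ : Fin N => Finset.range (p ^ l)),
          (-1 : K) ^ (∑ i, t i) * (∑ i, ω i * (t i : K)) ^ j) * x ^ (-(k : ℤ) - (j : ℤ)) := by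
      intro l
      have := hasSum_sum (s := Fintype.piFinset (fun _ : Fin N => Finset.range (p ^ l)))
        fun t _ => (aux_binom k hk x (∑ i, ω i * (t i : K))
          ((hy t).trans_lt hMx)).mul_left ((-1 : K) ^ (∑ i, t i))
      rw [← this.tsum_eq]
      refine tsum_congr fun j => ?_
      rw [Finset.mul_sum, Finset.sum_mul]
      refine Finset.sum_congr rfl fun t _ => ?_
      ring
    simp_rw [key]
    exact tendsto_tsum_of_dominated_convergence hsum
      (fun j => ((hT j).const_mul _).mul_const _)
      (Filter.Eventually.of_forall fun l j => hB j _ (hS l j))
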